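/- arXiv:1507.00845 — 2 statements merged into one kernel-verified Lean document; each statement's English description precedes it below -/
import Mathlib

section
/- Let 0 < α < 1, let (λ_n)_{n≥1} be positive reals, and let (c_n)_{n≥1} be reals with ∑_{n=1}^∞ |c_n| < ∞. Then the function f(t) = ∑_{n=1}^∞ c_n E_{α,1}(−λ_n t^α) is real-analytic on the open interval (0, ∞). -/
/-- The Mittag-Leffler function `E_{α,β}(x) = ∑_{k=0}^∞ x^k / Γ(αk + β)` for real `x`,
where `1/Γ` is interpreted as its entire extension (Mathlib's `Real.Gamma` vanishes at the
poles, so division yields `0` there). The series converges absolutely for every `x`. -/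
noncomputable def mittagLeffler (α β x : ℝ) : ℝ :=
  ∑' k : ℕ, x ^ k / Real.Gamma (α * k + β)

open Complex MeasureTheory Filter Set
open scoped Topology FourierTransform

/-- A parametric integral of uniformly dominated holomorphic functions is holomorphic. -/
theorem differentiableOn_integral_of_dominated {X : Type*} [MeasurableSpace X] {μ : Measure X}
    {U : Set ℂ} (hU : IsOpen U) {F : ℂ → X → ℂ} {bound : X → ℝ}
    (hmeas : ∀ w ∈ U, AEStronglyMeasurable (F w) μ) (hint : Integrable bound μ)
    (hbound : ∀ᵐ a ∂μ, ∀ w ∈ U, ‖F w a‖ ≤ bound a)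
    (hdiff : ∀ᵐ a ∂μ, DifferentiableOn ℂ (fun w => F w a) U) :
    DifferentiableOn ℂ (fun w => ∫ a, F w a ∂μ) U := by
  intro w₀ hw₀
  obtain ⟨ε, hε, hball⟩ := Metric.isOpen_iff.1 hU w₀ hw₀
  have hsub : ∀ x ∈ Metric.ball w₀ (ε / 2), Metric.closedBall x (ε / 4) ⊆ U := by
    intro x hx y hy
    apply hball
    rw [Metric.mem_ball] at hx ⊢
    rw [Metric.mem_closedBall] at hy
    linarith [dist_triangle y x w₀]
  have hmem : ∀ᶠ w in 𝓝 w₀, w ∈ U := hU.mem_nhds hw₀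
  have hderiv : ∀ᵐ a ∂μ, ∀ x ∈ Metric.ball w₀ (ε / 2),
      HasDerivAt (fun w => F w a) (deriv (fun w => F w a) x) x := by
    filter_upwards [hdiff] with a ha x hx
    have hxU : x ∈ U := hsub x hx (Metric.mem_closedBall_self (by positivity))
    exact (ha.differentiableAt (hU.mem_nhds hxU)).hasDerivAt
  have hderiv_meas : AEStronglyMeasurable (fun a => deriv (fun w => F w a) w₀) μ := by
    let h : ℕ → ℂ := fun n => ((ε / 2) * (1 / ((n : ℝ) + 1)) : ℝ)
    have hh0 : ∀ n, h n ≠ 0 := fun n => by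
      simp only [h, ne_eq, ofReal_eq_zero]; positivity
    have hhU : ∀ n, w₀ + h n ∈ U := by
      intro n
      apply hball
      have h1 : 1 / ((n : ℝ) + 1) ≤ 1 := by
        rw [div_le_one (by positivity)]; linarith [n.cast_nonneg (α := ℝ)]
      rw [Metric.mem_ball, dist_eq_norm, add_sub_cancel_left, norm_real,
        Real.norm_of_nonneg (by positivity)]
      nlinarith
    have hh : Tendsto h atTop (𝓝[≠] 0) := by
      refine tendsto_nhdsWithin_iff.2 ⟨?_, Eventually.of_forall hh0⟩
      have := (tendsto_one_div_add_atTop_nhds_zero_nat (𝕜 := ℝ)).const_mul (ε / 2)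
      rw [mul_zero] at this
      exact (continuous_ofReal.tendsto' 0 0 ofReal_zero).comp this
    refine aestronglyMeasurable_of_tendsto_ae atTop
      (f := fun n a => (h n)⁻¹ • (F (w₀ + h n) a - F w₀ a)) ?_ ?_
    · exact fun n => ((hmeas _ (hhU n)).sub (hmeas _ hw₀)).const_smul (h n)⁻¹
    · filter_upwards [hderiv] with a ha
      exact (hasDerivAt_iff_tendsto_slope_zero.1
        (ha w₀ (Metric.mem_ball_self (by positivity)))).comp hh
  refine (hasDerivAt_integral_of_dominated_loc_of_deriv_le (bound := fun a => bound a / (ε / 4))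
    (F' := fun w a => deriv (fun w => F w a) w)
    (Metric.ball_mem_nhds w₀ (half_pos hε)) (hmem.mono hmeas) ?_ hderiv_meas ?_
    (hint.div_const _) hderiv).2.differentiableAt.differentiableWithinAt
  · exact hint.mono' (hmeas _ hw₀) (hbound.mono fun a ha => ha _ hw₀)
  · filter_upwards [hbound, hdiff] with a hb hd x hx
    refine Complex.norm_deriv_le_of_forall_mem_sphere_norm_le (by positivity) ?_
      fun z hz => hb z (hsub x hx (Metric.sphere_subset_closedBall hz))
    exact (hd.mono (hsub x hx)).diffContOnCl_ball subset_rfl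

/-- The Laplace transform of `t ^ (s - 1)` at a complex frequency. -/
theorem integral_cpow_mul_exp_neg_mul_Ioi_of_re_pos {s : ℝ} (hs : 0 < s) {p : ℂ}
    (hp : 0 < p.re) :
    ∫ t : ℝ in Ioi 0, (t : ℂ) ^ ((s : ℂ) - 1) * cexp (-(p * t)) =
      p ^ (-(s : ℂ)) * Complex.Gamma s := by
  have hnorm : ∀ q : ℂ, ∀ t ∈ Ioi (0 : ℝ),
      ‖(t : ℂ) ^ ((s : ℂ) - 1) * cexp (-(q * t))‖ = t ^ (s - 1) * Real.exp (-q.re * t) := by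
    intro q t ht
    rw [norm_mul, norm_exp, norm_cpow_eq_rpow_re_of_pos ht]
    simp
  have hopen : IsOpen {q : ℂ | 0 < q.re} := isOpen_lt continuous_const continuous_re
  have hL : DifferentiableOn ℂ
      (fun q : ℂ => ∫ t : ℝ in Ioi 0, (t : ℂ) ^ ((s : ℂ) - 1) * cexp (-(q * t)))
      {q : ℂ | 0 < q.re} := by
    intro q hq
    have hq' : 0 < q.re := hq
    have hV : IsOpen {z : ℂ | q.re / 2 < z.re} := isOpen_lt continuous_const continuous_re
    refine (DifferentiableOn.differentiableAt (s := {z : ℂ | q.re / 2 < z.re}) ?_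
      (hV.mem_nhds (by simpa using hq'))).differentiableWithinAt
    have hi := integrableOn_rpow_mul_exp_neg_mul_rpow (p := 1) (s := s - 1) (b := q.re / 2)
      (by linarith) one_pos (by positivity)
    refine differentiableOn_integral_of_dominated hV
      (bound := fun t => t ^ (s - 1) * Real.exp (-(q.re / 2) * t)) ?_
      (by simpa [IntegrableOn] using hi) ?_ ?_
    · intro w _
      refine ContinuousOn.aestronglyMeasurable (fun t ht => ?_) measurableSet_Ioi
      refine ContinuousAt.continuousWithinAt (ContinuousAt.mul ?_ (by fun_prop))
      exact continuousAt_ofReal_cpow_const _ _ (Or.inr (ne_of_gt ht))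
    · filter_upwards [ae_restrict_mem measurableSet_Ioi] with t ht w hw
      rw [hnorm w t ht]
      have h0 : (0 : ℝ) < t := ht
      have hw' : q.re / 2 < w.re := hw
      gcongr
    · exact Eventually.of_forall fun t => by fun_prop
  have hR : DifferentiableOn ℂ (fun q : ℂ => q ^ (-(s : ℂ)) * Complex.Gamma s)
      {q : ℂ | 0 < q.re} := by
    intro q hq
    exact ((differentiableAt_id.cpow_const (Or.inl hq)).mul_const _).differentiableWithinAt
  have hpre : IsPreconnected {q : ℂ | 0 < q.re} := (convex_halfSpace_re_gt 0).isPreconnected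
  have hone : (1 : ℂ) ∈ {q : ℂ | 0 < q.re} := by simp
  refine (hL.analyticOnNhd hopen).eqOn_of_preconnected_of_frequently_eq
    (hR.analyticOnNhd hopen) hpre hone ?_ hp
  let h : ℕ → ℂ := fun n => (1 + 1 / ((n : ℝ) + 1) : ℝ)
  have hh : Tendsto h atTop (𝓝[≠] 1) := by
    refine tendsto_nhdsWithin_iff.2 ⟨?_, Eventually.of_forall fun n => ?_⟩
    · have := (tendsto_one_div_add_atTop_nhds_zero_nat (𝕜 := ℝ)).const_add 1
      rw [add_zero] at this
      exact (continuous_ofReal.tendsto' 1 1 ofReal_one).comp this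
    · have : (1 : ℝ) / ((n : ℝ) + 1) ≠ 0 := by positivity
      simp only [h, mem_compl_iff, mem_singleton_iff]
      norm_cast
      simpa using this
  refine hh.frequently (Frequently.of_forall fun n => ?_)
  have hpos : 0 < 1 + 1 / ((n : ℝ) + 1) := by positivity
  have := Complex.integral_cpow_mul_exp_neg_mul_Ioi (a := s) (by simpa using hs) hpos
  simp only [h]
  rw [this, one_div, ← ofReal_inv, ← ofReal_neg, ← ofReal_cpow hpos.le,
    ← ofReal_cpow (inv_nonneg.2 hpos.le),
    Real.rpow_neg hpos.le, Real.inv_rpow hpos.le]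

/-- The vertical line of abscissa `c`, parametrized by frequency. -/
noncomputable def bromwichLine (c ξ : ℝ) : ℂ := c + 2 * Real.pi * ξ * I

@[simp] theorem bromwichLine_re (c ξ : ℝ) : (bromwichLine c ξ).re = c := by simp [bromwichLine]

@[simp] theorem bromwichLine_im (c ξ : ℝ) : (bromwichLine c ξ).im = 2 * Real.pi * ξ := by
  simp [bromwichLine]

theorem bromwichLine_mem_slitPlane {c : ℝ} (hc : 0 < c) (ξ : ℝ) :
    bromwichLine c ξ ∈ slitPlane := Or.inl (by simpa using hc)

theorem bromwichLine_ne_zero {c : ℝ} (hc : 0 < c) (ξ : ℝ) : bromwichLine c ξ ≠ 0 :=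
  slitPlane_ne_zero (bromwichLine_mem_slitPlane hc ξ)

theorem le_norm_bromwichLine (c ξ : ℝ) : c ≤ ‖bromwichLine c ξ‖ := by
  simpa using re_le_norm (bromwichLine c ξ)

theorem continuous_bromwichLine (c : ℝ) : Continuous (bromwichLine c) := by
  unfold bromwichLine; fun_prop

theorem continuous_bromwichLine_cpow {c : ℝ} (hc : 0 < c) (s : ℂ) :
    Continuous fun ξ => bromwichLine c ξ ^ s :=
  (continuous_bromwichLine c).cpow continuous_const (bromwichLine_mem_slitPlane hc)

theorem norm_bromwichLine_cpow (c s ξ : ℝ) :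
    ‖bromwichLine c ξ ^ (-(s : ℂ))‖ = ‖bromwichLine c ξ‖ ^ (-s) := by
  rw [← ofReal_neg, norm_cpow_real]

theorem norm_bromwichLine_cpow_le {c s : ℝ} (hc : 0 < c) (hs : 0 ≤ s) (ξ : ℝ) :
    ‖bromwichLine c ξ ^ (-(s : ℂ))‖ ≤ c ^ (-s) := by
  rw [norm_bromwichLine_cpow]
  exact Real.rpow_le_rpow_of_nonpos hc (le_norm_bromwichLine c ξ) (by linarith)

theorem integrable_bromwichLine_cpow {c s : ℝ} (hc : 0 < c) (hs : 2 ≤ s) :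
    Integrable fun ξ => bromwichLine c ξ ^ (-(s : ℂ)) := by
  have hi : Integrable fun ξ : ℝ =>
      c ^ (-(s - 2)) * (c ^ (-2 : ℝ) * (1 + (ξ * (2 * Real.pi / c)) ^ 2)⁻¹) :=
    ((integrable_inv_one_add_sq.comp_mul_right' (by positivity)).const_mul _).const_mul _
  refine hi.mono' (continuous_bromwichLine_cpow hc _).aestronglyMeasurable
    (Eventually.of_forall fun ξ => ?_)
  have hn : 0 < ‖bromwichLine c ξ‖ := norm_pos_iff.2 (bromwichLine_ne_zero hc ξ)
  rw [norm_bromwichLine_cpow, show -s = -(s - 2) + (-2) by ring, Real.rpow_add hn]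
  have h2 : ‖bromwichLine c ξ‖ ^ (-2 : ℝ) = c ^ (-2 : ℝ) * (1 + (ξ * (2 * Real.pi / c)) ^ 2)⁻¹ := by
    rw [Real.rpow_neg hn.le, Real.rpow_neg hc.le, ← mul_inv, Real.rpow_two, Real.rpow_two,
      ← normSq_eq_norm_sq, normSq_apply, bromwichLine_re, bromwichLine_im]
    congr 1
    field_simp
  rw [h2]
  exact mul_le_mul_of_nonneg_right
    (Real.rpow_le_rpow_of_nonpos hc (le_norm_bromwichLine c ξ) (by linarith)) (by positivity)

theorem norm_exp_bromwichLine (c ξ : ℝ) : ‖cexp (bromwichLine c ξ)‖ = Real.exp c := by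
  simp [norm_exp]

/-- The Bromwich integral for the reciprocal Gamma function. -/
theorem integral_exp_mul_bromwichLine_cpow {c s : ℝ} (hc : 0 < c) (hs : 2 ≤ s) :
    ∫ ξ, cexp (bromwichLine c ξ) * bromwichLine c ξ ^ (-(s : ℂ)) = (Complex.Gamma s)⁻¹ := by
  have hs0 : 0 < s := by linarith
  let f : ℝ → ℂ := (Ioi 0).indicator fun t => (t : ℂ) ^ ((s : ℂ) - 1) * cexp (-(c * t))
  have hmeas : AEStronglyMeasurable (fun t : ℝ => (t : ℂ) ^ ((s : ℂ) - 1) * cexp (-(c * t)))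
      (volume.restrict (Ioi 0)) := by
    refine ContinuousOn.aestronglyMeasurable (fun t ht => ?_) measurableSet_Ioi
    refine ContinuousAt.continuousWithinAt (ContinuousAt.mul ?_ (by fun_prop))
    exact continuousAt_ofReal_cpow_const _ _ (Or.inr (ne_of_gt ht))
  have hf : Integrable f := by
    rw [integrable_indicator_iff measurableSet_Ioi]
    have hi := integrableOn_rpow_mul_exp_neg_mul_rpow (p := 1) (s := s - 1) (b := c)
      (by linarith) one_pos hc
    refine Integrable.mono' hi hmeas ?_
    filter_upwards [ae_restrict_mem measurableSet_Ioi] with t ht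
    rw [norm_mul, norm_exp, norm_cpow_eq_rpow_re_of_pos ht]
    simp
  have hF : 𝓕 f = fun ξ => bromwichLine c ξ ^ (-(s : ℂ)) * Complex.Gamma s := by
    ext ξ
    rw [Real.fourier_real_eq_integral_exp_smul,
      ← integral_cpow_mul_exp_neg_mul_Ioi_of_re_pos hs0
        (by simpa using hc : 0 < (bromwichLine c ξ).re),
      ← integral_indicator measurableSet_Ioi]
    congr 1 with t
    by_cases ht : t ∈ Ioi (0 : ℝ)
    · simp only [f, indicator_of_mem ht, smul_eq_mul]
      rw [mul_left_comm, ← Complex.exp_add]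
      congr 2
      simp only [bromwichLine]
      push_cast
      ring
    · simp only [f, indicator_of_notMem ht, smul_zero]
  have hFi : Integrable (𝓕 f) := by
    rw [hF]
    exact (integrable_bromwichLine_cpow hc hs).mul_const _
  have hcont : ContinuousAt f 1 := by
    have : (fun t : ℝ => (t : ℂ) ^ ((s : ℂ) - 1) * cexp (-(c * t))) =ᶠ[𝓝 1] f := by
      filter_upwards [Ioi_mem_nhds one_pos] with t ht
      simp only [f, indicator_of_mem ht]
    refine ContinuousAt.congr (ContinuousAt.mul ?_ (by fun_prop)) this
    exact continuousAt_ofReal_cpow_const _ _ (Or.inr one_ne_zero)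
  have hinv := hf.fourierInv_fourier_eq hFi hcont
  rw [Real.fourierInv_eq', hF] at hinv
  have hΓ : Complex.Gamma s ≠ 0 := Complex.Gamma_ne_zero_of_re_pos (by simpa using hs0)
  have hf1 : f 1 = cexp (-c) := by
    simp [f]
  rw [hf1] at hinv
  have hcongr : ∀ ξ : ℝ, cexp (bromwichLine c ξ) * bromwichLine c ξ ^ (-(s : ℂ)) =
      (cexp c * (Complex.Gamma s)⁻¹) * (cexp (↑(2 * Real.pi * inner ℝ ξ 1) * I) •
        (bromwichLine c ξ ^ (-(s : ℂ)) * Complex.Gamma s)) := by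
    intro ξ
    have : cexp (bromwichLine c ξ) = cexp c * cexp (↑(2 * Real.pi * inner ℝ ξ 1) * I) := by
      rw [← Complex.exp_add]
      simp [bromwichLine]
    rw [this, smul_eq_mul]
    field_simp
  simp_rw [hcongr]
  rw [integral_const_mul, hinv, mul_right_comm, ← Complex.exp_add]
  simp

/-- The sum of `∑ (α k + 1) (-q) ^ k`. -/
noncomputable def mittagLefflerSymbol (α : ℝ) (q : ℂ) : ℂ := 1 / (1 + q) - α * q / (1 + q) ^ 2

theorem hasSum_mittagLefflerSymbol (α : ℝ) {q : ℂ} (hq : ‖q‖ < 1) :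
    HasSum (fun k : ℕ => ((α * k + 1 : ℝ) : ℂ) * (-q) ^ k) (mittagLefflerSymbol α q) := by
  have hq' : ‖-q‖ < 1 := by rwa [norm_neg]
  have hsymbol : mittagLefflerSymbol α q = α * (-q / (1 - -q) ^ 2) + (1 - -q)⁻¹ := by
    rw [mittagLefflerSymbol, sub_neg_eq_add]
    ring
  rw [hsymbol]
  refine (((hasSum_coe_mul_geometric_of_norm_lt_one hq').mul_left (α : ℂ)).add
    (hasSum_geometric_of_norm_lt_one hq')).congr_fun fun k => ?_
  push_cast
  ring

theorem one_le_norm_one_add {q : ℂ} (hq : 0 ≤ q.re) : 1 ≤ ‖1 + q‖ :=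
  le_trans (by simpa using hq) (re_le_norm (1 + q))

theorem one_add_ne_zero_of_re_nonneg {q : ℂ} (hq : 0 ≤ q.re) : 1 + q ≠ 0 :=
  norm_pos_iff.1 (one_pos.trans_le (one_le_norm_one_add hq))

theorem norm_le_norm_one_add {q : ℂ} (hq : 0 ≤ q.re) : ‖q‖ ≤ ‖1 + q‖ := by
  rw [← sq_le_sq₀ (norm_nonneg _) (norm_nonneg _), ← normSq_eq_norm_sq, ← normSq_eq_norm_sq,
    normSq_apply, normSq_apply]
  simp only [add_re, one_re, add_im, one_im]
  nlinarith

theorem norm_mittagLefflerSymbol_le {α : ℝ} (hα : 0 ≤ α) {q : ℂ} (hq : 0 ≤ q.re) :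
    ‖mittagLefflerSymbol α q‖ ≤ 1 + α := by
  have h1 := one_le_norm_one_add hq
  have h2 := norm_le_norm_one_add hq
  have h0 : 0 < ‖1 + q‖ := by linarith
  refine (norm_sub_le _ _).trans (add_le_add ?_ ?_)
  · rw [norm_div, norm_one]
    exact (div_le_one h0).2 h1
  · rw [norm_div, norm_mul, norm_pow, norm_real, Real.norm_of_nonneg hα, mul_div_assoc]
    refine mul_le_of_le_one_right hα ((div_le_one (by positivity)).2 ?_)
    nlinarith

theorem differentiableAt_mittagLefflerSymbol (α : ℝ) {q : ℂ} (hq : 0 ≤ q.re) :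
    DifferentiableAt ℂ (mittagLefflerSymbol α) q := by
  have := one_add_ne_zero_of_re_nonneg hq
  unfold mittagLefflerSymbol
  fun_prop (disch := simp [this])

/-- A Bromwich integral representing `w ↦ E_{α,1}(-w)`. -/
noncomputable def mittagLefflerIntegral (α c : ℝ) (w : ℂ) : ℂ :=
  ∫ ξ, cexp (bromwichLine c ξ) * bromwichLine c ξ ^ (-(2 : ℝ) : ℂ) *
    mittagLefflerSymbol α (w * bromwichLine c ξ ^ (-(α : ℂ)))

theorem hasSum_mittagLefflerIntegral {α c : ℝ} (hα : 0 < α) (hc : 0 < c) {w : ℂ}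
    (hw : ‖w‖ < c ^ α) :
    HasSum (fun k : ℕ => (-w) ^ k / Complex.Gamma ((α * k + 1 : ℝ) : ℂ))
      (mittagLefflerIntegral α c w) := by
  set r : ℝ := ‖w‖ * c ^ (-α) with hr
  have hr0 : 0 ≤ r := by positivity
  have hr1 : r < 1 := by
    rw [hr, Real.rpow_neg hc.le, ← div_eq_mul_inv]
    exact (div_lt_one (by positivity)).2 hw
  have hq : ∀ ξ, ‖w * bromwichLine c ξ ^ (-(α : ℂ))‖ ≤ r := fun ξ => by
    rw [norm_mul]
    exact mul_le_mul_of_nonneg_left (norm_bromwichLine_cpow_le hc hα.le ξ) (norm_nonneg w)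
  let F : ℕ → ℝ → ℂ := fun k ξ => cexp (bromwichLine c ξ) * bromwichLine c ξ ^ (-(2 : ℝ) : ℂ) *
    (((α * k + 1 : ℝ) : ℂ) * (-(w * bromwichLine c ξ ^ (-(α : ℂ)))) ^ k)
  let g : ℝ → ℝ := fun ξ => Real.exp c * ‖bromwichLine c ξ ^ (-(2 : ℝ) : ℂ)‖
  have hg : Integrable g := (integrable_bromwichLine_cpow hc le_rfl).norm.const_mul _
  have hFg : ∀ k ξ, ‖F k ξ‖ ≤ (α * k + 1) * r ^ k * g ξ := fun k ξ => by
    have hk : 0 ≤ α * k + 1 := by positivity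
    simp only [F, g]
    rw [norm_mul, norm_mul, norm_mul, norm_exp_bromwichLine, norm_pow, norm_neg, norm_real,
      Real.norm_of_nonneg hk, mul_comm]
    gcongr
    exact hq ξ
  have hFmeas : ∀ k, AEStronglyMeasurable (F k) volume := fun k => by
    have h1 := continuous_bromwichLine c
    have h2 := continuous_bromwichLine_cpow hc (-(2 : ℝ))
    have h3 := continuous_bromwichLine_cpow hc (-(α : ℂ))
    exact Continuous.aestronglyMeasurable (by fun_prop)
  have hFint : ∀ k, Integrable (F k) := fun k =>
    (hg.const_mul _).mono' (hFmeas k) (Eventually.of_forall (hFg k))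
  have hsummable : Summable fun k : ℕ => (α * k + 1) * r ^ k := by
    have hrn : ‖r‖ < 1 := by rwa [Real.norm_of_nonneg hr0]
    refine (((hasSum_coe_mul_geometric_of_norm_lt_one hrn).mul_left α).add
      (hasSum_geometric_of_norm_lt_one hrn)).summable.congr fun k => ?_
    ring
  have hFsum : Summable fun k => ∫ ξ, ‖F k ξ‖ := by
    refine Summable.of_nonneg_of_le (fun k => integral_nonneg fun _ => norm_nonneg _) (fun k => ?_)
      (hsummable.mul_right (∫ ξ, g ξ))
    rw [← integral_const_mul]
    exact integral_mono (hFint k).norm (hg.const_mul _) (hFg k)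
  have hmain := hasSum_integral_of_summable_integral_norm hFint hFsum
  have htsum : ∫ ξ, ∑' k, F k ξ = mittagLefflerIntegral α c w := by
    refine integral_congr_ae (Eventually.of_forall fun ξ => ?_)
    exact ((hasSum_mittagLefflerSymbol α ((hq ξ).trans_lt hr1)).mul_left _).tsum_eq
  rw [htsum] at hmain
  refine hmain.congr_fun fun k => ?_
  have hk : 0 < α * k + 1 := by positivity
  have hkc : ((α * k + 1 : ℝ) : ℂ) ≠ 0 := by exact_mod_cast hk.ne'
  have hterm : ∀ ξ, F k ξ = ((α * k + 1 : ℝ) : ℂ) * (-w) ^ k *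
      (cexp (bromwichLine c ξ) * bromwichLine c ξ ^ (-((α * k + 1 + 1 : ℝ) : ℂ))) := fun ξ => by
    have hp := bromwichLine_ne_zero hc ξ
    have : bromwichLine c ξ ^ (-((α * k + 1 + 1 : ℝ) : ℂ)) =
        bromwichLine c ξ ^ (-(2 : ℝ) : ℂ) * (bromwichLine c ξ ^ (-(α : ℂ))) ^ k := by
      rw [← cpow_mul_nat, ← cpow_add _ _ hp]
      congr 1
      push_cast
      ring
    simp only [F]
    rw [this, ← neg_mul, mul_pow]
    ring
  simp_rw [hterm]
  rw [integral_const_mul, integral_exp_mul_bromwichLine_cpow hc (by nlinarith),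
    ofReal_add (α * k + 1) 1, ofReal_one, Complex.Gamma_add_one _ hkc]
  field_simp

/-- An open sector around the positive real axis. -/
def realSector (κ : ℝ) : Set ℂ := {w | |w.im| < κ * w.re}

theorem isOpen_realSector (κ : ℝ) : IsOpen (realSector κ) :=
  isOpen_lt (by fun_prop) (by fun_prop)

theorem convex_realSector (κ : ℝ) : Convex ℝ (realSector κ) := by
  intro x hx y hy a b ha hb hab
  simp only [realSector, mem_ofPred_eq, add_re, add_im, real_smul, re_ofReal_mul, im_ofReal_mul,
    abs_lt] at *
  constructor <;> rcases ha.eq_or_lt with rfl | ha' <;> nlinarith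

theorem ofReal_mem_realSector {κ x : ℝ} (hκ : 0 < κ) (hx : 0 < x) : (x : ℂ) ∈ realSector κ := by
  simpa [realSector] using mul_pos hκ hx

theorem ofReal_mul_mem_realSector {κ x : ℝ} (hx : 0 < x) {w : ℂ} (hw : w ∈ realSector κ) :
    (x : ℂ) * w ∈ realSector κ := by
  simp only [realSector, mem_ofPred_eq, re_ofReal_mul, im_ofReal_mul, abs_mul, abs_of_pos hx] at *
  nlinarith

theorem cos_pi_div_two_mul_pos {α : ℝ} (hα0 : 0 < α) (hα1 : α < 1) :
    0 < Real.cos (Real.pi / 2 * α) :=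
  Real.cos_pos_of_mem_Ioo ⟨by nlinarith [Real.pi_pos], by nlinarith [Real.pi_pos]⟩

theorem re_mul_bromwichLine_cpow_nonneg {α c : ℝ} (hα0 : 0 < α) (hα1 : α < 1) (hc : 0 < c)
    {w : ℂ} (hw : w ∈ realSector (Real.cos (Real.pi / 2 * α))) (ξ : ℝ) :
    0 ≤ (w * bromwichLine c ξ ^ (-(α : ℂ))).re := by
  set θ := arg (bromwichLine c ξ)
  have hθ : |θ| ≤ Real.pi / 2 := abs_arg_le_pi_div_two_iff.2 (by simpa using hc.le)
  have hcos : Real.cos (Real.pi / 2 * α) ≤ Real.cos (θ * α) := by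
    rw [← Real.cos_abs (θ * α), abs_mul, abs_of_pos hα0]
    refine Real.cos_le_cos_of_nonneg_of_le_pi (by positivity) ?_ (by gcongr)
    nlinarith [Real.pi_pos]
  have hκ : 0 < Real.cos (Real.pi / 2 * α) :=
    cos_pi_div_two_mul_pos hα0 hα1
  have hw' : |w.im| < Real.cos (Real.pi / 2 * α) * w.re := hw
  have hre : 0 < w.re := pos_of_mul_pos_right ((abs_nonneg _).trans_lt hw') hκ.le
  rw [← ofReal_neg, cpow_ofReal, mul_left_comm, re_ofReal_mul]
  refine mul_nonneg (by positivity) ?_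
  simp only [mul_re, add_re, add_im, mul_im, ofReal_re, ofReal_im, I_re, I_im]
  have hsin := Real.abs_sin_le_one (θ * -α)
  have h1 : w.im * Real.sin (θ * -α) ≤ |w.im| := by
    refine (le_abs_self _).trans ?_
    rw [abs_mul]
    exact mul_le_of_le_one_right (abs_nonneg _) hsin
  have h2 : Real.cos (θ * -α) = Real.cos (θ * α) := by rw [mul_neg, Real.cos_neg]
  rw [h2]
  nlinarith

theorem norm_mittagLefflerIntegrand_le {α c : ℝ} (hα0 : 0 < α) (hα1 : α < 1) (hc : 0 < c)
    {w : ℂ} (hw : w ∈ realSector (Real.cos (Real.pi / 2 * α))) (ξ : ℝ) :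
    ‖cexp (bromwichLine c ξ) * bromwichLine c ξ ^ (-(2 : ℝ) : ℂ) *
      mittagLefflerSymbol α (w * bromwichLine c ξ ^ (-(α : ℂ)))‖ ≤
    Real.exp c * ‖bromwichLine c ξ ^ (-(2 : ℝ) : ℂ)‖ * (1 + α) := by
  rw [norm_mul, norm_mul, norm_exp_bromwichLine]
  gcongr
  exact norm_mittagLefflerSymbol_le hα0.le (re_mul_bromwichLine_cpow_nonneg hα0 hα1 hc hw ξ)

theorem integrable_mittagLefflerIntegrand_bound {c : ℝ} (hc : 0 < c) (α : ℝ) :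
    Integrable fun ξ => Real.exp c * ‖bromwichLine c ξ ^ (-(2 : ℝ) : ℂ)‖ * (1 + α) :=
  ((integrable_bromwichLine_cpow hc le_rfl).norm.const_mul _).mul_const _

theorem exists_norm_mittagLefflerIntegral_le {α c : ℝ} (hα0 : 0 < α) (hα1 : α < 1)
    (hc : 0 < c) :
    ∃ C, ∀ w ∈ realSector (Real.cos (Real.pi / 2 * α)), ‖mittagLefflerIntegral α c w‖ ≤ C :=
  ⟨_, fun _ hw => norm_integral_le_of_norm_le (integrable_mittagLefflerIntegrand_bound hc α)
    (Eventually.of_forall (norm_mittagLefflerIntegrand_le hα0 hα1 hc hw))⟩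

theorem differentiableOn_mittagLefflerIntegral {α c : ℝ} (hα0 : 0 < α) (hα1 : α < 1)
    (hc : 0 < c) :
    DifferentiableOn ℂ (mittagLefflerIntegral α c)
      (realSector (Real.cos (Real.pi / 2 * α))) := by
  refine differentiableOn_integral_of_dominated (isOpen_realSector _) (fun w hw => ?_)
    (integrable_mittagLefflerIntegrand_bound hc α)
    (Eventually.of_forall fun ξ w hw => norm_mittagLefflerIntegrand_le hα0 hα1 hc hw ξ)
    (Eventually.of_forall fun ξ w hw => ?_)
  · refine Continuous.aestronglyMeasurable (Continuous.mul (Continuous.mul ?_ ?_) ?_)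
    · exact Complex.continuous_exp.comp (continuous_bromwichLine c)
    · exact continuous_bromwichLine_cpow hc _
    · refine continuous_iff_continuousAt.2 fun ξ => ?_
      exact ContinuousAt.comp (f := fun ξ => w * bromwichLine c ξ ^ (-(α : ℂ)))
        (differentiableAt_mittagLefflerSymbol α
          (re_mul_bromwichLine_cpow_nonneg hα0 hα1 hc hw ξ)).continuousAt
        (continuous_const.mul (continuous_bromwichLine_cpow hc _)).continuousAt
  · have h := differentiableAt_mittagLefflerSymbol α
      (re_mul_bromwichLine_cpow_nonneg hα0 hα1 hc hw ξ)
    have h' : DifferentiableAt ℂ (fun w : ℂ => w * bromwichLine c ξ ^ (-(α : ℂ))) w := by fun_prop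
    exact ((h.comp w h').const_mul _).differentiableWithinAt

theorem eqOn_mittagLefflerIntegral {α c d : ℝ} (hα0 : 0 < α) (hα1 : α < 1)
    (hc : 0 < c) (hd : 0 < d) :
    EqOn (mittagLefflerIntegral α c) (mittagLefflerIntegral α d)
      (realSector (Real.cos (Real.pi / 2 * α))) := by
  have hκ : 0 < Real.cos (Real.pi / 2 * α) :=
    cos_pi_div_two_mul_pos hα0 hα1
  have hopen := isOpen_realSector (Real.cos (Real.pi / 2 * α))
  have hx : 0 < min (c ^ α) (d ^ α) / 2 := by positivity
  refine ((differentiableOn_mittagLefflerIntegral hα0 hα1 hc).analyticOnNhd hopen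
    ).eqOn_of_preconnected_of_eventuallyEq
    ((differentiableOn_mittagLefflerIntegral hα0 hα1 hd).analyticOnNhd hopen)
    (convex_realSector _).isPreconnected (ofReal_mem_realSector hκ hx) ?_
  have hnear : ∀ᶠ w : ℂ in 𝓝 ((min (c ^ α) (d ^ α) / 2 : ℝ) : ℂ), ‖w‖ < min (c ^ α) (d ^ α) := by
    refine continuous_norm.continuousAt.eventually_lt_const ?_
    simp only [norm_real, Real.norm_of_nonneg hx.le]
    linarith
  filter_upwards [hnear] with w hw
  exact (hasSum_mittagLefflerIntegral hα0 hc (hw.trans_le (min_le_left _ _))).unique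
    (hasSum_mittagLefflerIntegral hα0 hd (hw.trans_le (min_le_right _ _)))

theorem mittagLeffler_neg_eq_re_integral {α c x : ℝ} (hα0 : 0 < α) (hα1 : α < 1) (hc : 0 < c)
    (hx : 0 < x) : mittagLeffler α 1 (-x) = (mittagLefflerIntegral α c x).re := by
  have hκ : 0 < Real.cos (Real.pi / 2 * α) :=
    cos_pi_div_two_mul_pos hα0 hα1
  have hd : 0 < (x + 1) ^ α⁻¹ := by positivity
  have hlt : ‖(x : ℂ)‖ < ((x + 1) ^ α⁻¹) ^ α := by
    rw [← Real.rpow_mul (by positivity), inv_mul_cancel₀ hα0.ne', Real.rpow_one, norm_real,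
      Real.norm_of_nonneg hx.le]
    linarith
  rw [eqOn_mittagLefflerIntegral hα0 hα1 hc hd (ofReal_mem_realSector hκ hx)]
  refine HasSum.tsum_eq ((Complex.hasSum_re (hasSum_mittagLefflerIntegral hα0 hd hlt)).congr_fun
    fun k => ?_)
  rw [Complex.Gamma_ofReal, ← ofReal_neg, ← ofReal_pow, ← ofReal_div, ofReal_re]

/-- Let `0 < α < 1`, `(λ_n)` positive and `(c_n)` absolutely summable. Then
`f(t) = ∑_n c_n E_{α,1}(-λ_n t^α)` is real-analytic on `(0, ∞)`. -/
theorem mittagLeffler_sum_analyticAt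
    (α : ℝ) (hα0 : 0 < α) (hα1 : α < 1)
    (lam c : ℕ → ℝ) (hlam : ∀ n, 0 < lam n)
    (hsum : Summable (fun n => |c n|)) :
    ∀ t ∈ Set.Ioi (0 : ℝ),
      AnalyticAt ℝ (fun t : ℝ => ∑' n, c n * mittagLeffler α 1 (-lam n * t ^ α)) t := by
  intro t ht
  have ht0 : 0 < t := ht
  set κ := Real.cos (Real.pi / 2 * α)
  have hκ : 0 < κ :=
    cos_pi_div_two_mul_pos hα0 hα1
  obtain ⟨C, hC⟩ := exists_norm_mittagLefflerIntegral_le hα0 hα1 one_pos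
  let U : Set ℂ := slitPlane ∩ (fun z : ℂ => z ^ (α : ℂ)) ⁻¹' realSector κ
  have hpow : DifferentiableOn ℂ (fun z : ℂ => z ^ (α : ℂ)) slitPlane := fun z hz =>
    (differentiableAt_id.cpow_const hz).differentiableWithinAt
  have hU : IsOpen U :=
    hpow.continuousOn.isOpen_inter_preimage isOpen_slitPlane (isOpen_realSector κ)
  have hreal : ∀ x : ℝ, 0 < x → (x : ℂ) ∈ U := fun x hx =>
    ⟨ofReal_mem_slitPlane.2 hx, by
      rw [mem_preimage, ← ofReal_cpow hx.le]
      exact ofReal_mem_realSector hκ (by positivity)⟩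
  have hmem : ∀ n, ∀ z ∈ U, (lam n : ℂ) * z ^ (α : ℂ) ∈ realSector κ := fun n z hz =>
    ofReal_mul_mem_realSector (hlam n) hz.2
  let f : ℕ → ℂ → ℂ := fun n z => c n * mittagLefflerIntegral α 1 (lam n * z ^ (α : ℂ))
  have hbound : ∀ n, ∀ z ∈ U, ‖f n z‖ ≤ |c n| * C := fun n z hz => by
    rw [norm_mul, norm_real, Real.norm_eq_abs]
    exact mul_le_mul_of_nonneg_left (hC _ (hmem n z hz)) (abs_nonneg _)
  have hf : DifferentiableOn ℂ (fun z => ∑' n, f n z) U := by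
    refine differentiableOn_tsum_of_summable_norm (hsum.mul_right C) (fun n => ?_) hU hbound
    exact ((differentiableOn_mittagLefflerIntegral hα0 hα1 one_pos).comp
      ((hpow.mono inter_subset_left).const_mul _) (hmem n)).const_mul _
  refine ((hf.analyticAt (hU.mem_nhds (hreal t ht0))).re_ofReal).congr ?_
  filter_upwards [Ioi_mem_nhds ht0] with x hx
  have hx0 : 0 < x := hx
  have hs : Summable fun n => f n x :=
    Summable.of_norm_bounded (hsum.mul_right C) fun n => hbound n x (hreal x hx0)
  rw [Complex.re_tsum hs]
  refine tsum_congr fun n => ?_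
  have hpos : 0 < lam n * x ^ α := mul_pos (hlam n) (by positivity)
  rw [neg_mul, mittagLeffler_neg_eq_re_integral hα0 hα1 one_pos hpos, re_ofReal_mul, ofReal_mul,
    ofReal_cpow hx0.le]
end

section
/- Let 0 < α < 1, let (λ_n)_{n≥1} be positive reals, and let (c_n)_{n≥1} be reals with ∑_{n=1}^∞ |c_n| < ∞, and set f(t) = ∑_{n=1}^∞ c_n E_{α,1}(−λ_n t^α) for t > 0. If f vanishes on a subset S of (0, ∞) that has an accumulation point lying in (0, ∞), then f(t) = 0 for every t > 0. -/
open Finset Filter Topology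

/-- The generalized binomial coefficient `b (b + 1) ⋯ (b + n - 1) / n!`, which is the coefficient
of `z ^ n` in `(1 - z) ^ (-b)`. -/
noncomputable def risingBinom (b : ℝ) (n : ℕ) : ℝ :=
  ∏ j ∈ range n, (b + j) / (j + 1)

@[simp]
lemma risingBinom_zero (b : ℝ) : risingBinom b 0 = 1 := by simp [risingBinom]

lemma risingBinom_succ (b : ℝ) (n : ℕ) :
    risingBinom b (n + 1) = risingBinom b n * ((b + n) / (n + 1)) := by
  rw [risingBinom, prod_range_succ, risingBinom]

@[simp]
lemma risingBinom_one (n : ℕ) : risingBinom 1 n = 1 := by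
  refine prod_eq_one fun j _ => ?_
  rw [add_comm, div_self (by positivity)]

lemma risingBinom_nonneg {b : ℝ} (hb : 0 ≤ b) (n : ℕ) : 0 ≤ risingBinom b n :=
  prod_nonneg fun j _ => by positivity

lemma risingBinom_le_pow {a : ℝ} (ha : 0 ≤ a) (n : ℕ) :
    risingBinom (a + 1) n ≤ (a + 1) ^ n := by
  refine (prod_le_prod (g := fun _ => a + 1) (fun j _ => by positivity) fun j _ => ?_).trans
    (by simp)
  rw [div_le_iff₀ (by positivity)]
  nlinarith [mul_nonneg ha (j.cast_nonneg (α := ℝ)), j.cast_nonneg (α := ℝ)]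

lemma risingBinom_neg_succ_nonpos {α : ℝ} (hα0 : 0 ≤ α) (hα1 : α ≤ 1) (n : ℕ) :
    risingBinom (-α) (n + 1) ≤ 0 := by
  induction n with
  | zero => simpa [risingBinom_succ] using hα0
  | succ n ih =>
    rw [risingBinom_succ]
    refine mul_nonpos_of_nonpos_of_nonneg ih (div_nonneg ?_ (by positivity))
    push_cast
    linarith [n.cast_nonneg (α := ℝ)]

/-- Chu-Vandermonde identity. -/
lemma sum_risingBinom_mul (b c : ℝ) (n : ℕ) :
    ∑ p ∈ antidiagonal n, risingBinom b p.1 * risingBinom c p.2 = risingBinom (b + c) n := by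
  induction n with
  | zero => simp
  | succ n ih =>
    have hs (x : ℝ) (m : ℕ) : ((m + 1 : ℕ) : ℝ) * risingBinom x (m + 1)
        = (x + m) * risingBinom x m := by
      rw [risingBinom_succ]
      push_cast
      field_simp
    have hn : ((n + 1 : ℕ) : ℝ) ≠ 0 := by positivity
    refine mul_left_cancel₀ hn ?_
    rw [hs, ← ih, mul_sum, mul_sum]
    have h1 : ∑ p ∈ antidiagonal (n + 1),
        ((n + 1 : ℕ) : ℝ) * (risingBinom b p.1 * risingBinom c p.2)
        = ∑ p ∈ antidiagonal (n + 1), (p.1 * risingBinom b p.1) * risingBinom c p.2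
          + ∑ p ∈ antidiagonal (n + 1), risingBinom b p.1 * (p.2 * risingBinom c p.2) := by
      rw [← sum_add_distrib]
      refine sum_congr rfl fun p hp => ?_
      rw [← mem_antidiagonal.mp hp]
      push_cast
      ring
    rw [h1, Nat.sum_antidiagonal_succ, Nat.sum_antidiagonal_succ']
    simp only [hs, Nat.cast_zero, zero_mul, mul_zero, zero_add, ← sum_add_distrib]
    refine sum_congr rfl fun p hp => ?_
    rw [← mem_antidiagonal.mp hp]
    push_cast
    ring

lemma summable_succ_pow_mul_geometric (n : ℕ) {ρ : ℝ} (h0 : 0 ≤ ρ) (h1 : ρ < 1) :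
    Summable fun k : ℕ => ((k : ℝ) + 1) ^ n * ρ ^ k := by
  obtain ⟨r, hr, hr1⟩ := exists_between h1
  have hr0 : 0 < r := h0.trans_lt hr
  have h := (summable_nat_add_iff 1).mpr (summable_pow_mul_geometric_of_norm_lt_one (R := ℝ) n
    (r := r) (by rwa [Real.norm_of_nonneg hr0.le]))
  refine (h.mul_right r⁻¹).of_nonneg_of_le (fun k => by positivity) fun k => ?_
  rw [pow_succ r, mul_assoc, mul_assoc, mul_inv_cancel₀ hr0.ne', mul_one]
  push_cast
  gcongr

lemma risingBinom_mul_natCast_le {α : ℝ} (hα0 : 0 ≤ α) (hα1 : α ≤ 1) (n k : ℕ) :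
    risingBinom (α * k + 1) n ≤ ((k : ℝ) + 1) ^ n := by
  refine (risingBinom_le_pow (by positivity) n).trans ?_
  gcongr
  exact mul_le_of_le_one_left k.cast_nonneg hα1

/-- The coefficient of `z ^ n` in `(1 - z)⁻¹ (1 + ξ (1 - z) ^ (-α))⁻¹`, expanded in powers
of `ξ`. Up to the scaling `ξ = w n ^ (-α)` it approximates the Mittag-Leffler function at `-w`. -/
noncomputable def discreteMittagLeffler (α : ℝ) (ξ : ℂ) (n : ℕ) : ℂ :=
  ∑' k : ℕ, (-ξ) ^ k * (risingBinom (α * k + 1) n : ℂ)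

lemma summable_discreteMittagLeffler {α : ℝ} (hα0 : 0 ≤ α) (hα1 : α ≤ 1) {ξ : ℂ} (hξ : ‖ξ‖ < 1)
    (n : ℕ) : Summable fun k : ℕ => (-ξ) ^ k * (risingBinom (α * k + 1) n : ℂ) := by
  refine (summable_succ_pow_mul_geometric n (norm_nonneg ξ) hξ).of_norm_bounded fun k => ?_
  have h0 := risingBinom_nonneg (b := α * k + 1) (by positivity) n
  rw [norm_mul, norm_pow, norm_neg, Complex.norm_real, Real.norm_of_nonneg h0, mul_comm]
  gcongr
  exact risingBinom_mul_natCast_le hα0 hα1 n k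

lemma sum_risingBinom_mul_discreteMittagLeffler {α : ℝ} (hα0 : 0 ≤ α) (hα1 : α ≤ 1) {ξ : ℂ}
    (hξ : ‖ξ‖ < 1) (n : ℕ) :
    ∑ p ∈ antidiagonal n, (risingBinom (-α) p.1 : ℂ) * discreteMittagLeffler α ξ p.2
      = risingBinom (1 - α) n - ξ * discreteMittagLeffler α ξ n := by
  have hS := summable_discreteMittagLeffler hα0 hα1 hξ
  have h1 : ∑ p ∈ antidiagonal n, (risingBinom (-α) p.1 : ℂ) * discreteMittagLeffler α ξ p.2
      = ∑' k : ℕ, (-ξ) ^ k * (risingBinom (-α + (α * k + 1)) n : ℂ) := by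
    simp only [discreteMittagLeffler, ← tsum_mul_left]
    have hS' (p : ℕ × ℕ) := (hS p.2).mul_left (risingBinom (-α) p.1 : ℂ)
    rw [← Summable.tsum_finsetSum (fun p _ => hS' p)]
    refine tsum_congr fun k => ?_
    rw [← sum_risingBinom_mul]
    push_cast
    rw [mul_sum]
    exact sum_congr rfl fun p _ => by ring
  have h2 (k : ℕ) : (-ξ) ^ (k + 1) * (risingBinom (-α + (α * (k + 1 : ℕ) + 1)) n : ℂ)
      = -ξ * ((-ξ) ^ k * (risingBinom (α * k + 1) n : ℂ)) := by
    have : -α + (α * (k + 1 : ℕ) + 1) = α * k + 1 := by push_cast; ring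
    rw [this]
    ring
  have hT : Summable fun k : ℕ => (-ξ) ^ k * (risingBinom (-α + (α * k + 1)) n : ℂ) :=
    (summable_nat_add_iff 1).mp (((hS n).mul_left (-ξ)).congr fun k => (h2 k).symm)
  have h3 : -α + (α * (0 : ℕ) + 1) = 1 - α := by push_cast; ring
  rw [h1, hT.tsum_eq_zero_add, tsum_congr h2, tsum_mul_left, h3, discreteMittagLeffler]
  ring

lemma norm_discreteMittagLeffler_le_one {α : ℝ} (hα0 : 0 ≤ α) (hα1 : α ≤ 1) {ξ : ℂ}
    (hξ : ‖ξ‖ < 1) (hre : 0 ≤ ξ.re) (n : ℕ) : ‖discreteMittagLeffler α ξ n‖ ≤ 1 := by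
  have h1 : 1 ≤ ‖1 + ξ‖ := by
    refine le_trans ?_ (Complex.re_le_norm _)
    simpa using hre
  have hpos := risingBinom_nonneg (sub_nonneg.mpr hα1)
  suffices h : ‖(1 + ξ) * discreteMittagLeffler α ξ n‖ ≤ 1 by
    rw [norm_mul] at h
    nlinarith [norm_nonneg (discreteMittagLeffler α ξ n)]
  have hrec := sum_risingBinom_mul_discreteMittagLeffler hα0 hα1 hξ
  induction n using Nat.strong_induction_on with
  | _ n ih =>
  cases n with
  | zero =>
    have h := hrec 0
    simp only [Nat.antidiagonal_zero, sum_singleton, risingBinom_zero, Complex.ofReal_one,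
      one_mul] at h
    rw [show (1 + ξ) * discreteMittagLeffler α ξ 0 = 1 by linear_combination h, norm_one]
  | succ n =>
    have h := hrec (n + 1)
    have hw := sum_risingBinom_mul (-α) 1 (n + 1)
    rw [Nat.sum_antidiagonal_succ] at h hw
    simp only [risingBinom_zero, Complex.ofReal_one, one_mul, risingBinom_one, mul_one] at h hw
    have hU : (1 + ξ) * discreteMittagLeffler α ξ (n + 1) = risingBinom (1 - α) (n + 1)
        - ∑ p ∈ antidiagonal n,
          (risingBinom (-α) (p.1 + 1) : ℂ) * discreteMittagLeffler α ξ p.2 := by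
      linear_combination h
    have hsum : ‖∑ p ∈ antidiagonal n,
        (risingBinom (-α) (p.1 + 1) : ℂ) * discreteMittagLeffler α ξ p.2‖
        ≤ ∑ p ∈ antidiagonal n, -risingBinom (-α) (p.1 + 1) := by
      refine norm_sum_le_of_le _ fun p hp => ?_
      have hp2 := ih p.2 (by have := mem_antidiagonal.mp hp; omega)
      rw [norm_mul] at hp2
      have hU1 : ‖discreteMittagLeffler α ξ p.2‖ ≤ 1 := by
        nlinarith [norm_nonneg (discreteMittagLeffler α ξ p.2)]
      have hneg := risingBinom_neg_succ_nonpos hα0 hα1 p.1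
      rw [norm_mul, Complex.norm_real, Real.norm_of_nonpos hneg]
      exact mul_le_of_le_one_right (neg_nonneg.mpr hneg) hU1
    rw [hU]
    refine (norm_sub_le _ _).trans ?_
    rw [Complex.norm_real, Real.norm_of_nonneg (hpos _)]
    rw [sum_neg_distrib] at hsum
    rw [show -α + 1 = 1 - α by ring] at hw
    linarith

lemma antitone_risingBinom_mul_rpow {a : ℝ} (ha : 0 ≤ a) {m n : ℕ} (hm : 1 ≤ m) (hmn : m ≤ n) :
    risingBinom (a + 1) n * (n : ℝ) ^ (-a) ≤ risingBinom (a + 1) m * (m : ℝ) ^ (-a) := by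
  induction n, hmn using Nat.le_induction with
  | base => rfl
  | succ n hn ih =>
    refine le_trans ?_ ih
    have hn0 : (0 : ℝ) < n := by exact_mod_cast hm.trans hn
    rw [risingBinom_succ, mul_assoc]
    refine mul_le_mul_of_nonneg_left ?_ (risingBinom_nonneg (by positivity) n)
    have hq : (0 : ℝ) < ((n + 1 : ℕ) : ℝ) / n := by positivity
    have hlog := Real.one_sub_inv_le_log_of_pos hq
    have h1 : (a + 1 + n) / (n + 1) ≤ (((n + 1 : ℕ) : ℝ) / n) ^ a := by
      rw [Real.rpow_def_of_pos hq]
      refine le_trans ?_ (Real.add_one_le_exp _)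
      have h2 := mul_le_mul_of_nonneg_right hlog ha
      have h3 : (a + 1 + n) / ((n : ℝ) + 1) = (1 - (((n + 1 : ℕ) : ℝ) / n)⁻¹) * a + 1 := by
        push_cast
        field_simp
        ring
      linarith
    rw [Real.div_rpow (by positivity) hn0.le] at h1
    rw [Real.rpow_neg (by positivity), Real.rpow_neg hn0.le, ← div_eq_mul_inv,
      div_le_iff₀ (by positivity), mul_comm, ← div_eq_mul_inv]
    exact h1

lemma tendsto_risingBinom_mul_rpow {a : ℝ} (ha : 0 ≤ a) :
    Tendsto (fun n : ℕ => risingBinom (a + 1) n * (n : ℝ) ^ (-a)) atTop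
      (𝓝 (Real.Gamma (a + 1))⁻¹) := by
  have hG : Real.Gamma (a + 1) ≠ 0 := (Real.Gamma_pos_of_pos (by positivity)).ne'
  have h := ((Real.GammaSeq_tendsto_Gamma (a + 1)).inv₀ hG).mul
    (tendsto_natCast_div_add_atTop (a + 1))
  rw [mul_one] at h
  refine h.congr' ?_
  filter_upwards [eventually_gt_atTop 0] with n hn
  have hn0 : (0 : ℝ) < n := by exact_mod_cast hn
  have hprod : ∏ j ∈ range n, (a + 1 + (j : ℝ)) = risingBinom (a + 1) n * n.factorial := by
    rw [risingBinom, prod_div_distrib, ← prod_range_add_one_eq_factorial]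
    push_cast
    rw [div_mul_cancel₀]
    positivity
  have h2 : (n : ℝ) + (a + 1) ≠ 0 := by positivity
  rw [Real.GammaSeq, prod_range_succ, hprod, Real.rpow_add hn0, Real.rpow_one,
    Real.rpow_neg hn0.le]
  field_simp
  ring

lemma exists_summable_pow_mul_risingBinom {α : ℝ} (hα0 : 0 < α) (hα1 : α ≤ 1) {R : ℝ}
    (hR : 0 ≤ R) :
    ∃ N : ℕ, 1 ≤ N ∧
      Summable fun k : ℕ => R ^ k * (risingBinom (α * k + 1) N * (N : ℝ) ^ (-(α * k))) := by
  have ht : Tendsto (fun n : ℕ => R * (n : ℝ) ^ (-α)) atTop (𝓝 0) := by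
    simpa using ((tendsto_rpow_neg_atTop hα0).comp tendsto_natCast_atTop_atTop).const_mul R
  obtain ⟨N, hN, hN1⟩ := ((ht.eventually (gt_mem_nhds one_pos)).and (eventually_ge_atTop 1)).exists
  refine ⟨N, hN1, ?_⟩
  refine (summable_succ_pow_mul_geometric N (by positivity) hN).of_nonneg_of_le
    (fun k => ?_) fun k => ?_
  · have := risingBinom_nonneg (b := α * k + 1) (by positivity) N
    positivity
  · rw [← neg_mul, Real.rpow_mul_natCast (by positivity), mul_pow, mul_left_comm]
    gcongr
    exact risingBinom_mul_natCast_le hα0.le hα1 N k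

lemma summable_pow_div_Gamma {α : ℝ} (hα0 : 0 < α) (hα1 : α ≤ 1) {R : ℝ} (hR : 0 ≤ R) :
    Summable fun k : ℕ => R ^ k / Real.Gamma (α * k + 1) := by
  obtain ⟨N, hN, hs⟩ := exists_summable_pow_mul_risingBinom hα0 hα1 hR
  refine hs.of_nonneg_of_le (fun k => ?_) fun k => ?_
  · have := Real.Gamma_pos_of_pos (s := α * k + 1) (by positivity)
    positivity
  · rw [div_eq_mul_inv]
    gcongr
    refine le_of_tendsto (tendsto_risingBinom_mul_rpow (by positivity)) ?_
    filter_upwards [eventually_ge_atTop N] with n hn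
    exact antitone_risingBinom_mul_rpow (by positivity) hN hn

/-- The Mittag-Leffler function `E_{α,1}` of a complex variable. -/
noncomputable def complexMittagLeffler (α : ℝ) (z : ℂ) : ℂ :=
  ∑' k : ℕ, z ^ k / (Real.Gamma (α * k + 1) : ℂ)

lemma complexMittagLeffler_ofReal (α x : ℝ) :
    complexMittagLeffler α x = mittagLeffler α 1 x := by
  rw [complexMittagLeffler, mittagLeffler, Complex.ofReal_tsum]
  push_cast
  rfl

lemma differentiable_complexMittagLeffler {α : ℝ} (hα0 : 0 < α) (hα1 : α ≤ 1) :
    Differentiable ℂ (complexMittagLeffler α) := by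
  intro z
  have hd : DifferentiableOn ℂ (complexMittagLeffler α) (Metric.ball 0 (‖z‖ + 1)) := by
    refine Complex.differentiableOn_tsum_of_summable_norm
      (summable_pow_div_Gamma hα0 hα1 (R := ‖z‖ + 1) (by positivity))
      (fun k => by fun_prop) Metric.isOpen_ball fun k w hw => ?_
    have hG := Real.Gamma_pos_of_pos (s := α * k + 1) (by positivity)
    rw [norm_div, norm_pow, Complex.norm_real, Real.norm_of_nonneg hG.le]
    gcongr
    exact (mem_ball_zero_iff.mp hw).le
  exact hd.differentiableAt (Metric.isOpen_ball.mem_nhds (by simp))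

lemma norm_complexMittagLeffler_neg_le_one {α : ℝ} (hα0 : 0 < α) (hα1 : α ≤ 1) {w : ℂ}
    (hw : 0 ≤ w.re) : ‖complexMittagLeffler α (-w)‖ ≤ 1 := by
  obtain ⟨N, hN, hs⟩ := exists_summable_pow_mul_risingBinom hα0 hα1 (norm_nonneg w)
  have hlim : Tendsto (fun n : ℕ => ∑' k : ℕ,
      (-w) ^ k * ((risingBinom (α * k + 1) n * (n : ℝ) ^ (-(α * k)) : ℝ) : ℂ)) atTop
      (𝓝 (complexMittagLeffler α (-w))) := by
    refine tendsto_tsum_of_dominated_convergence hs (fun k => ?_) ?_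
    · rw [div_eq_mul_inv, ← Complex.ofReal_inv]
      exact ((Complex.continuous_ofReal.tendsto _).comp
        (tendsto_risingBinom_mul_rpow (by positivity))).const_mul _
    · filter_upwards [eventually_ge_atTop N] with n hn k
      have h0 := risingBinom_nonneg (b := α * k + 1) (by positivity) n
      rw [norm_mul, norm_pow, norm_neg, Complex.norm_real, Real.norm_of_nonneg (by positivity)]
      exact mul_le_mul_of_nonneg_left (antitone_risingBinom_mul_rpow (by positivity) hN hn)
        (by positivity)
  refine le_of_tendsto hlim.norm ?_
  have ht : Tendsto (fun n : ℕ => ‖w‖ * (n : ℝ) ^ (-α)) atTop (𝓝 0) := by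
    simpa using ((tendsto_rpow_neg_atTop hα0).comp tendsto_natCast_atTop_atTop).const_mul ‖w‖
  filter_upwards [ht.eventually (gt_mem_nhds one_pos)] with n hn
  have hp : (0 : ℝ) ≤ (n : ℝ) ^ (-α) := by positivity
  have hU : ∑' k : ℕ, (-w) ^ k * ((risingBinom (α * k + 1) n * (n : ℝ) ^ (-(α * k)) : ℝ) : ℂ)
      = discreteMittagLeffler α (w * ((n : ℝ) ^ (-α) : ℝ)) n := by
    refine tsum_congr fun k => ?_
    rw [← neg_mul α, Real.rpow_mul_natCast (by positivity)]
    push_cast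
    ring
  rw [hU]
  refine norm_discreteMittagLeffler_le_one hα0.le hα1 ?_ ?_ n
  · rwa [norm_mul, Complex.norm_real, Real.norm_of_nonneg hp]
  · rw [Complex.re_mul_ofReal]
    positivity

/-- Let `0 < α < 1`, `(λ_n)` positive, `(c_n)` absolutely summable, and set
`f(t) = ∑_n c_n E_{α,1}(-λ_n t^α)`. If `f` vanishes on a set `S ⊆ (0,∞)` having an
accumulation point in `(0,∞)`, then `f(t) = 0` for every `t > 0`. -/
theorem mittagLeffler_sum_eq_zero_of_vanishing_on_acc_set
    (α : ℝ) (hα0 : 0 < α) (hα1 : α < 1)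
    (lam c : ℕ → ℝ) (hlam : ∀ n, 0 < lam n)
    (hsum : Summable (fun n => |c n|))
    (f : ℝ → ℝ) (hf : ∀ t : ℝ, f t = ∑' n, c n * mittagLeffler α 1 (-lam n * t ^ α))
    (S : Set ℝ) (hS : S ⊆ Set.Ioi 0)
    (hvan : ∀ t ∈ S, f t = 0)
    (hacc : ∃ t₀ ∈ Set.Ioi (0 : ℝ), AccPt t₀ (Filter.principal S)) :
    ∀ t : ℝ, 0 < t → f t = 0 := by
  obtain ⟨t₀, ht₀, hacc⟩ := hacc
  set F : ℂ → ℂ := fun w => ∑' n, (c n : ℂ) * complexMittagLeffler α (-(lam n * w))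
  set H : Set ℂ := {w | 0 < w.re} with hH
  have hHo : IsOpen H := isOpen_lt continuous_const Complex.continuous_re
  have hFd : DifferentiableOn ℂ F H := by
    refine Complex.differentiableOn_tsum_of_summable_norm hsum (fun n => ?_) hHo fun n w hw => ?_
    · exact (((differentiable_complexMittagLeffler hα0 hα1.le).comp
        (by fun_prop : Differentiable ℂ fun w : ℂ => -(lam n * w))).const_mul _).differentiableOn
    · rw [norm_mul, Complex.norm_real, Real.norm_eq_abs]
      refine mul_le_of_le_one_right (abs_nonneg _)
        (norm_complexMittagLeffler_neg_le_one hα0 hα1.le ?_)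
      rw [Complex.re_ofReal_mul]
      exact mul_nonneg (hlam n).le (le_of_lt hw)
  have hFf (t : ℝ) : F ((t ^ α : ℝ) : ℂ) = f t := by
    rw [hf, Complex.ofReal_tsum]
    refine tsum_congr fun n => ?_
    rw [Complex.ofReal_mul, ← complexMittagLeffler_ofReal]
    push_cast
    rw [neg_mul]
  have hmem {t : ℝ} (ht : 0 < t) : ((t ^ α : ℝ) : ℂ) ∈ H := by
    rw [hH, Set.mem_ofPred_eq, Complex.ofReal_re]
    positivity
  have hpow : Tendsto (fun t : ℝ => ((t ^ α : ℝ) : ℂ)) (𝓝 t₀) (𝓝 ((t₀ ^ α : ℝ) : ℂ)) :=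
    (Complex.continuous_ofReal.tendsto _).comp
      (Real.continuousAt_rpow_const t₀ α (Or.inr hα0.le))
  have hfreq : ∃ᶠ w in 𝓝[≠] ((t₀ ^ α : ℝ) : ℂ), F w = 0 := by
    rw [accPt_iff_frequently] at hacc
    rw [frequently_nhdsWithin_iff]
    refine hpow.frequently (hacc.mono fun t ht => ⟨?_, fun h => ht.1 ?_⟩)
    · rw [hFf, hvan t ht.2, Complex.ofReal_zero]
    · exact (Real.rpow_left_inj (le_of_lt (hS ht.2)) (le_of_lt ht₀) hα0.ne').mp
        (Complex.ofReal_injective h)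
  have hzero := (hFd.analyticOnNhd hHo).eqOn_zero_of_preconnected_of_frequently_eq_zero
    (convex_halfSpace_re_gt 0).isPreconnected (hmem ht₀) hfreq
  intro t ht
  exact Complex.ofReal_injective ((hFf t).symm.trans (hzero (hmem ht)))
end
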